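/- (Tail Bound) Let b ≥ 2 be the number of symbols of the alphabet Ω, let i ∈ ℕ₀ and let λ > 0 be real. Then for every k ≥ max{24, 2·log₂(λ+1)}, μ^ℕ({x ∈ Ω^ℕ : |μ^k({ω ∈ Ω^k : M_k^x((0,λ])(ω) = i}) − e^{−λ} λ^i / i!| > 2/k}) ≤ 2·exp(−2·b^k / (λ·k^4)). -/

import Mathlib

open MeasureTheory Filter

/-- The uniform product measure μ^k on Ω^k, Ω = Fin b: normalized counting measure. -/
noncomputable def muK (b k : ℕ) : Measure (Fin k → Fin b) :=
  ((b : ENNReal) ^ k)⁻¹ • Measure.count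

/-- ν is the product measure μ^ℕ of uniform measures on Ω = Fin b over Ω^ℕ:
every cylinder of length n has measure b^{-n}. -/
def IsUnifProductMeasure (b : ℕ) (ν : Measure (ℕ → Fin b)) : Prop :=
  ∀ (n : ℕ) (w : Fin n → Fin b),
    ν {x | ∀ t : Fin n, x (t : ℕ) = w t} = ((b : ENNReal)⁻¹) ^ n

/-- The word w (of length k) occurs in x at position j (positions numbered from 1):
I_j(x,w) = 1. -/
def OccursAt {b k : ℕ} (x : ℕ → Fin b) (j : ℕ) (w : Fin k → Fin b) : Prop :=
  ∀ t : Fin k, x (j - 1 + (t : ℕ)) = w t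

instance {b k : ℕ} (x : ℕ → Fin b) (j : ℕ) (w : Fin k → Fin b) :
    Decidable (OccursAt x j w) := by unfold OccursAt; infer_instance

/-- M_k^x(S)(w) = Σ_{j ∈ ℕ ∩ b^k S} I_j(x,w): the number of positive integers j with
j/b^k ∈ S at which w occurs in x. -/
noncomputable def Mx (b k : ℕ) (S : Set ℝ) (x : ℕ → Fin b) (w : Fin k → Fin b) : ℕ :=
  {j : ℕ | 1 ≤ j ∧ ((j : ℝ) / (b : ℝ) ^ k) ∈ S ∧ OccursAt x j w}.ncard

/-- Z^λ_{i,k}(x): proportion of words of length k occurring exactly i times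
among positions 1 ≤ j ≤ λ b^k of x. -/
noncomputable def Z (b k i : ℕ) (lam : ℝ) (x : ℕ → Fin b) : ℝ :=
  ((Finset.univ.filter (fun w : Fin k → Fin b =>
      ((Finset.Icc 1 ⌊lam * (b : ℝ) ^ k⌋₊).filter (fun j => OccursAt x j w)).card = i)).card : ℝ)
    / (b : ℝ) ^ k

/-- x is λ-Poisson generic. -/
def LamPoissonGeneric (b : ℕ) (lam : ℝ) (x : ℕ → Fin b) : Prop :=
  ∀ i : ℕ, Tendsto (fun k : ℕ => Z b k i lam x) atTop
    (nhds (Real.exp (-lam) * lam ^ i / (Nat.factorial i : ℝ)))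

/-- x is Poisson generic. -/
def PoissonGeneric (b : ℕ) (x : ℕ → Fin b) : Prop :=
  ∀ lam : ℝ, 0 < lam → LamPoissonGeneric b lam x

/-- S ⊆ [0,∞) is a finite union of pairwise disjoint intervals with rational endpoints. -/
def IsFinRatIntervalUnion (S : Set ℝ) : Prop :=
  ∃ (n : ℕ) (p q : Fin n → ℚ), (∀ m, 0 ≤ p m) ∧
    (Pairwise fun m l : Fin n =>
      Disjoint (Set.Ioo ((p m : ℝ)) ((q m : ℝ))) (Set.Ioo ((p l : ℝ)) ((q l : ℝ)))) ∧
    S = ⋃ m, Set.Ioo ((p m : ℝ)) ((q m : ℝ))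

/-- Total variation distance between two laws on ℕ (given as set functions). -/
noncomputable def dTV (P Q : Set ℕ → ℝ) : ℝ := ⨆ A : Set ℕ, |P A - Q A|

/-- The law on ℕ of M_k(S) under μ^ℕ × μ^k. -/
noncomputable def lawM (b k : ℕ) (ν : Measure (ℕ → Fin b)) (S : Set ℝ) (A : Set ℕ) : ℝ :=
  ((ν.prod (muK b k)) {p : (ℕ → Fin b) × (Fin k → Fin b) | Mx b k S p.1 p.2 ∈ A}).toReal

/-- The law on ℕ of M_k^x(S) under μ^k. -/
noncomputable def lawMx (b k : ℕ) (x : ℕ → Fin b) (S : Set ℝ) (A : Set ℕ) : ℝ :=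
  ((muK b k) {w : Fin k → Fin b | Mx b k S x w ∈ A}).toReal

/-- The Poisson law with mean λ, as a set function on ℕ. -/
noncomputable def poissonLaw (lam : ℝ) (A : Set ℕ) : ℝ :=
  ∑' i : A, Real.exp (-lam) * lam ^ (i : ℕ) / (Nat.factorial (i : ℕ) : ℝ)

open scoped BigOperators

/-- The sequence `g` shifted by one: the value of `g` at `i - 1`, read as `0` when `i = 0`. -/
def precWeight (g : ℕ → ℝ) : ℕ → ℝ
  | 0 => 0
  | i + 1 => g i

/-- The Poisson weight of index `i` as a function of the mean. -/
noncomputable def poissonWeight (t : ℝ) (i : ℕ) : ℝ := Real.exp (-t) * t ^ i / (i.factorial : ℝ)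

lemma poissonWeight_nonneg {t : ℝ} (ht : 0 ≤ t) (i : ℕ) : 0 ≤ poissonWeight t i := by
  unfold poissonWeight; positivity

lemma poissonWeight_le_one {t : ℝ} (ht : 0 ≤ t) (i : ℕ) : poissonWeight t i ≤ 1 := by
  have h := Real.pow_div_factorial_le_exp t ht i
  unfold poissonWeight
  rw [mul_div_assoc, Real.exp_neg, inv_mul_le_iff₀ (Real.exp_pos _), mul_one]
  exact h

lemma precWeight_mem_Icc {g : ℕ → ℝ} (hg : ∀ i, g i ∈ Set.Icc (0 : ℝ) 1) (i : ℕ) :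
    precWeight g i ∈ Set.Icc (0 : ℝ) 1 := by
  cases i with
  | zero => simp [precWeight]
  | succ i => exact hg i

lemma poissonWeight_mem_Icc {t : ℝ} (ht : 0 ≤ t) (i : ℕ) :
    poissonWeight t i ∈ Set.Icc (0 : ℝ) 1 :=
  ⟨poissonWeight_nonneg ht i, poissonWeight_le_one ht i⟩

lemma hasDerivAt_poissonWeight (t : ℝ) (i : ℕ) :
    HasDerivAt (fun t => poissonWeight t i)
      (precWeight (poissonWeight t) i - poissonWeight t i) t := by
  have h := (((hasDerivAt_neg t).exp).mul (hasDerivAt_pow i t)).div_const (i.factorial : ℝ)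
  refine h.congr_deriv ?_
  cases i with
  | zero => simp [precWeight, poissonWeight]
  | succ i =>
    have h1 : ((i + 1 : ℕ) : ℝ) ≠ 0 := by positivity
    have h2 : ((i.factorial : ℕ) : ℝ) ≠ 0 := by positivity
    simp only [precWeight, poissonWeight, Nat.factorial_succ, Nat.cast_mul, Nat.add_sub_cancel]
    field_simp
    ring

lemma abs_poissonWeight_sub_le {s t : ℝ} (hs : 0 ≤ s) (ht : 0 ≤ t) (i : ℕ) :
    |poissonWeight s i - poissonWeight t i| ≤ |s - t| := by
  have h := (convex_Ici (0 : ℝ)).norm_image_sub_le_of_norm_hasDerivWithin_le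
    (f := fun t => poissonWeight t i) (C := 1)
    (fun x _ => (hasDerivAt_poissonWeight x i).hasDerivWithinAt)
    (fun x hx => by
      have h1 := poissonWeight_mem_Icc (Set.mem_Ici.mp hx) i
      have h2 := precWeight_mem_Icc (poissonWeight_mem_Icc (Set.mem_Ici.mp hx)) i
      rw [Real.norm_eq_abs, abs_le]
      constructor <;> linarith [h1.1, h1.2, h2.1, h2.2]) (Set.mem_Ici.mpr ht) (Set.mem_Ici.mpr hs)
  simpa using h

lemma abs_precWeight_poissonWeight_sub_le {s t : ℝ} (hs : 0 ≤ s) (ht : 0 ≤ t) (i : ℕ) :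
    |precWeight (poissonWeight s) i - precWeight (poissonWeight t) i| ≤ |s - t| := by
  cases i with
  | zero => simp [precWeight]
  | succ i => exact abs_poissonWeight_sub_le hs ht i

/-- A Poisson step of size `q` is a Bernoulli step of parameter `q` up to `2 * q ^ 2`. -/
lemma abs_poissonWeight_add_sub_le {t q : ℝ} (ht : 0 ≤ t) (hq : 0 ≤ q) (i : ℕ) :
    |poissonWeight (t + q) i -
      ((1 - q) * poissonWeight t i + q * precWeight (poissonWeight t) i)| ≤ 2 * q ^ 2 := by
  have h := (convex_Icc t (t + q)).norm_image_sub_le_of_norm_hasDerivWithin_le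
    (f := fun s => poissonWeight s i - s * (precWeight (poissonWeight t) i - poissonWeight t i))
    (C := 2 * q)
    (fun x _ => ((hasDerivAt_poissonWeight x i).sub
      ((hasDerivAt_id x).mul_const _)).hasDerivWithinAt)
    (fun x hx => by
      have hx0 : 0 ≤ x := ht.trans hx.1
      have hxt : |x - t| ≤ q := by rw [abs_le]; constructor <;> linarith [hx.1, hx.2]
      have h1 := abs_le.mp ((abs_poissonWeight_sub_le hx0 ht i).trans hxt)
      have h2 := abs_le.mp ((abs_precWeight_poissonWeight_sub_le hx0 ht i).trans hxt)
      rw [Real.norm_eq_abs, abs_le]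
      constructor <;> linarith [h1.1, h1.2, h2.1, h2.2])
    (Set.left_mem_Icc.mpr (by linarith)) (Set.right_mem_Icc.mpr (by linarith))
  rw [Real.norm_eq_abs, Real.norm_eq_abs, add_sub_cancel_left, abs_of_nonneg hq] at h
  calc _ = _ := by congr 1; ring
    _ ≤ _ := h
    _ = _ := by ring

lemma poissonWeight_zero (i : ℕ) : poissonWeight 0 i = if i = 0 then 1 else 0 := by
  cases i <;> simp [poissonWeight]

/-- Hoeffding's lemma for the uniform measure on a finite type. -/
lemma expect_exp_sub_expect_le {A : Type*} [Fintype A] [Nonempty A] (f : A → ℝ) (c s : ℝ)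
    (hf : ∀ a a', |f a - f a'| ≤ c) :
    𝔼 a, Real.exp (s * (f a - 𝔼 a', f a')) ≤ Real.exp (s ^ 2 * c ^ 2 / 8) := by
  let _ : MeasurableSpace A := ⊤
  have hint : ∀ g : A → ℝ, ∫ a, g a ∂(PMF.uniformOfFintype A).toMeasure = 𝔼 a, g a := by
    intro g
    rw [PMF.integral_eq_sum, Finset.expect_eq_sum_div_card, Finset.sum_div]
    refine Finset.sum_congr rfl fun a _ => ?_
    simp [div_eq_inv_mul]
  obtain ⟨a₀, ha₀⟩ := Finite.exists_min f
  have hmem : ∀ᵐ a ∂(PMF.uniformOfFintype A).toMeasure, f a ∈ Set.Icc (f a₀) (f a₀ + c) :=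
    ae_of_all _ fun a => ⟨ha₀ a, by linarith [le_abs_self (f a - f a₀), hf a a₀]⟩
  have key := (ProbabilityTheory.hasSubgaussianMGF_of_mem_Icc
    (measurable_of_finite f).aemeasurable hmem).mgf_le s
  rw [ProbabilityTheory.mgf, hint, hint] at key
  refine key.trans (le_of_eq ?_)
  congr 1
  simp only [add_sub_cancel_left, NNReal.coe_pow, NNReal.coe_div, coe_nnnorm,
    Real.norm_eq_abs, NNReal.coe_ofNat, div_pow, sq_abs]
  ring

/-- The exponential moment bound behind McDiarmid's bounded differences inequality. -/
lemma expect_exp_sub_expect_le_of_bounded_diff {A : Type*} [Fintype A] [Nonempty A] (n : ℕ)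
    (f : (Fin n → A) → ℝ) (c s : ℝ)
    (hf : ∀ m y y', (∀ l, l ≠ m → y l = y' l) → |f y - f y'| ≤ c) :
    𝔼 y, Real.exp (s * (f y - 𝔼 y', f y')) ≤ Real.exp (n * (s ^ 2 * c ^ 2 / 8)) := by
  induction n with
  | zero => simp [Finset.univ_unique]
  | succ n ih =>
    have hsplit : ∀ g : (Fin (n + 1) → A) → ℝ,
        𝔼 y, g y = 𝔼 y : Fin n → A, 𝔼 a, g (Fin.cons a y) := by
      intro g
      rw [Finset.expect_comm, ← Finset.expect_product', Finset.univ_product_univ]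
      exact (Fintype.expect_equiv (Fin.consEquiv fun _ => A) _ _ fun _ => rfl).symm
    set g : (Fin n → A) → ℝ := fun y => 𝔼 a, f (Fin.cons a y) with hg
    have hgdiff : ∀ m y y', (∀ l, l ≠ m → y l = y' l) → |g y - g y'| ≤ c := by
      intro m y y' h
      rw [hg]
      simp only [← Finset.expect_sub_distrib]
      refine (Finset.abs_expect_le _ _).trans
        (Finset.expect_le Finset.univ_nonempty fun a _ => ?_)
      refine hf m.succ _ _ fun l hl => ?_
      cases l using Fin.cases with
      | zero => simp
      | succ l => simpa using h l (by simpa using hl)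
    rw [hsplit, hsplit f]
    calc 𝔼 y : Fin n → A, 𝔼 a, Real.exp (s * (f (Fin.cons a y) - 𝔼 y, g y))
        = 𝔼 y : Fin n → A, Real.exp (s * (g y - 𝔼 y, g y)) *
            𝔼 a, Real.exp (s * (f (Fin.cons a y) - g y)) := by
          refine Finset.expect_congr rfl fun y _ => ?_
          rw [Finset.mul_expect]
          refine Finset.expect_congr rfl fun a _ => ?_
          rw [← Real.exp_add]
          congr 1
          ring
      _ ≤ 𝔼 y : Fin n → A, Real.exp (s * (g y - 𝔼 y, g y)) * Real.exp (s ^ 2 * c ^ 2 / 8) := by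
          refine Finset.expect_le_expect fun y _ => ?_
          refine mul_le_mul_of_nonneg_left ?_ (Real.exp_pos _).le
          refine expect_exp_sub_expect_le (fun a => f (Fin.cons a y)) c s fun a a' => ?_
          refine hf 0 _ _ fun l hl => ?_
          cases l using Fin.cases with
          | zero => exact absurd rfl hl
          | succ l => simp
      _ ≤ Real.exp (n * (s ^ 2 * c ^ 2 / 8)) * Real.exp (s ^ 2 * c ^ 2 / 8) := by
          rw [← Finset.expect_mul]
          exact mul_le_mul_of_nonneg_right (ih g hgdiff) (Real.exp_pos _).le
      _ = _ := by
          rw [← Real.exp_add]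
          congr 1
          push_cast
          ring

/-- One-sided McDiarmid inequality for the uniform measure on a finite power. -/
lemma card_filter_sub_expect_gt_le {A : Type*} [Fintype A] [Nonempty A] (n : ℕ) (hn : 0 < n)
    (f : (Fin n → A) → ℝ) (c t : ℝ) (hc : 0 < c) (ht : 0 < t)
    (hf : ∀ m y y', (∀ l, l ≠ m → y l = y' l) → |f y - f y'| ≤ c) :
    ((Finset.univ.filter fun y => t < f y - 𝔼 y', f y').card : ℝ) ≤
      Fintype.card (Fin n → A) * Real.exp (-2 * t ^ 2 / (n * c ^ 2)) := by
  have hn' : (0 : ℝ) < n := by exact_mod_cast hn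
  set s : ℝ := 4 * t / (n * c ^ 2) with hs
  have hs0 : 0 < s := by positivity
  have h := expect_exp_sub_expect_le_of_bounded_diff n f c s hf
  have hcard : (0 : ℝ) < Fintype.card (Fin n → A) := by exact_mod_cast Fintype.card_pos
  rw [Fintype.expect_eq_sum_div_card, div_le_iff₀ hcard] at h
  have hmarkov : ((Finset.univ.filter fun y => t < f y - 𝔼 y', f y').card : ℝ) * Real.exp (s * t)
      ≤ ∑ y, Real.exp (s * (f y - 𝔼 y', f y')) := by
    rw [← nsmul_eq_mul]
    refine (Finset.card_nsmul_le_sum _ _ _ fun y hy => ?_).trans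
      (Finset.sum_le_sum_of_subset_of_nonneg (Finset.filter_subset _ _)
        fun y _ _ => (Real.exp_pos _).le)
    have := (Finset.mem_filter.mp hy).2
    exact Real.exp_le_exp.mpr (mul_le_mul_of_nonneg_left this.le hs0.le)
  rw [← mul_le_mul_iff_of_pos_right (Real.exp_pos (s * t))]
  refine (hmarkov.trans h).trans (le_of_eq ?_)
  rw [mul_assoc, ← Real.exp_add, mul_comm]
  congr 2
  rw [hs]
  field_simp
  ring

/-- Two-sided McDiarmid inequality for the uniform measure on a finite power. -/
lemma card_filter_abs_sub_expect_gt_le {A : Type*} [Fintype A] [Nonempty A] (n : ℕ) (hn : 0 < n)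
    (f : (Fin n → A) → ℝ) (c t : ℝ) (hc : 0 < c) (ht : 0 < t)
    (hf : ∀ m y y', (∀ l, l ≠ m → y l = y' l) → |f y - f y'| ≤ c) :
    ((Finset.univ.filter fun y => t < |f y - 𝔼 y', f y'|).card : ℝ) ≤
      Fintype.card (Fin n → A) * (2 * Real.exp (-2 * t ^ 2 / (n * c ^ 2))) := by
  classical
  have h₁ := card_filter_sub_expect_gt_le n hn f c t hc ht hf
  have h₂ := card_filter_sub_expect_gt_le n hn (fun y => -f y) c t hc ht fun m y y' h => by
    rw [neg_sub_neg, abs_sub_comm]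
    exact hf m y y' h
  rw [Finset.expect_neg_distrib] at h₂
  have hsub : (Finset.univ.filter fun y => t < |f y - 𝔼 y', f y'|) ⊆
      (Finset.univ.filter fun y => t < f y - 𝔼 y', f y') ∪
        (Finset.univ.filter fun y => t < -f y - -𝔼 y', f y') := by
    intro y hy
    simp only [Finset.mem_filter, Finset.mem_union, Finset.mem_univ, true_and, lt_abs] at hy ⊢
    refine hy.imp id fun h => by linarith
  have h₃ : ((Finset.univ.filter fun y => t < |f y - 𝔼 y', f y'|).card : ℝ) ≤
      (Finset.univ.filter fun y => t < f y - 𝔼 y', f y').card +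
        (Finset.univ.filter fun y => t < -f y - -𝔼 y', f y').card := by
    exact_mod_cast (Finset.card_le_card hsub).trans (Finset.card_union_le _ _)
  linarith

/-- Extend a finite word to an infinite one by a constant symbol. -/
def extendWord {b T : ℕ} [NeZero b] (y : Fin T → Fin b) (n : ℕ) : Fin b :=
  if h : n < T then y ⟨n, h⟩ else 0

/-- Replace the letters of `y` at positions `n, …, n + k - 1` by those of `v`. -/
def overwrite {b T k : ℕ} (y : Fin T → Fin b) (n : ℕ) (v : Fin k → Fin b) : Fin T → Fin b :=
  fun m => if h : n ≤ m ∧ m - n < k then v ⟨m - n, h.2⟩ else y m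

/-- The number of occurrences of `w` in `x` starting at one of the first `n` positions. -/
def occCount {b k : ℕ} (x : ℕ → Fin b) (w : Fin k → Fin b) (n : ℕ) : ℕ :=
  ((Finset.range n).filter fun j => OccursAt x (j + 1) w).card

/-- The indicator of an occurrence of `w` in `x` after `j` letters, as a real number. -/
def occInd {b k : ℕ} (x : ℕ → Fin b) (j : ℕ) (w : Fin k → Fin b) : ℝ :=
  if OccursAt x (j + 1) w then 1 else 0

section

variable {b k T : ℕ}

lemma occursAt_succ_iff (x : ℕ → Fin b) (j : ℕ) (w : Fin k → Fin b) :
    OccursAt x (j + 1) w ↔ ∀ t : Fin k, x (j + t) = w t := Iff.rfl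

lemma occursAt_congr {x x' : ℕ → Fin b} {j : ℕ} (w : Fin k → Fin b)
    (h : ∀ m, j ≤ m → m < j + k → x m = x' m) :
    OccursAt x (j + 1) w ↔ OccursAt x' (j + 1) w := by
  simp only [occursAt_succ_iff]
  refine forall_congr' fun t => ?_
  rw [h (j + t) (by omega) (by omega)]

lemma occCount_congr {x x' : ℕ → Fin b} {n : ℕ} (w : Fin k → Fin b)
    (h : ∀ j < n, OccursAt x (j + 1) w ↔ OccursAt x' (j + 1) w) :
    occCount x w n = occCount x' w n := by
  unfold occCount
  congr 1
  exact Finset.filter_congr fun j hj => h j (Finset.mem_range.mp hj)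

lemma occCount_succ (x : ℕ → Fin b) (w : Fin k → Fin b) (n : ℕ) :
    occCount x w (n + 1) = occCount x w n + if OccursAt x (n + 1) w then 1 else 0 := by
  unfold occCount
  rw [Finset.range_add_one, Finset.filter_insert]
  split_ifs with h
  · rw [Finset.card_insert_of_notMem (by simp)]
  · rfl

lemma occInd_nonneg (x : ℕ → Fin b) (j : ℕ) (w : Fin k → Fin b) : 0 ≤ occInd x j w := by
  unfold occInd; split_ifs <;> norm_num

lemma apply_occCount_succ (g : ℕ → ℝ) (x : ℕ → Fin b) (w : Fin k → Fin b) (n : ℕ) :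
    g (occCount x w (n + 1)) = g (occCount x w n) +
      occInd x n w * (g (occCount x w n + 1) - g (occCount x w n)) := by
  rw [occCount_succ, occInd]
  split_ifs <;> simp

lemma abs_apply_occCount_sub_le {h : ℕ → ℝ} (hh : ∀ s, |h s| ≤ 1) (x : ℕ → Fin b)
    (w : Fin k → Fin b) {m n : ℕ} (hmn : m ≤ n) :
    |h (occCount x w n) - h (occCount x w m)| ≤ 2 * ∑ l ∈ Finset.Ico m n, occInd x l w := by
  by_cases hex : ∃ l ∈ Finset.Ico m n, OccursAt x (l + 1) w
  · obtain ⟨l, hl, hocc⟩ := hex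
    have h1 : (1 : ℝ) ≤ ∑ l ∈ Finset.Ico m n, occInd x l w := by
      refine le_trans ?_ (Finset.single_le_sum (fun j _ => occInd_nonneg x j w) hl)
      simp [occInd, hocc]
    have h2 := abs_sub (h (occCount x w n)) (h (occCount x w m))
    linarith [hh (occCount x w n), hh (occCount x w m)]
  · push Not at hex
    have heq : occCount x w n = occCount x w m := by
      unfold occCount
      congr 1
      ext l
      simp only [Finset.mem_filter, Finset.mem_range, Finset.mem_Ico] at hex ⊢
      refine ⟨fun ⟨h1, h2⟩ => ⟨?_, h2⟩, fun ⟨h1, h2⟩ => ⟨by omega, h2⟩⟩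
      by_contra h3
      exact hex l ⟨by omega, h1⟩ h2
    rw [heq, sub_self, abs_zero]
    exact mul_nonneg zero_le_two (Finset.sum_nonneg fun j _ => occInd_nonneg x j w)

variable [NeZero b]

lemma extendWord_of_lt (y : Fin T → Fin b) {n : ℕ} (h : n < T) : extendWord y n = y ⟨n, h⟩ :=
  dif_pos h

lemma extendWord_overwrite_add (y : Fin T → Fin b) {n : ℕ} (v : Fin k → Fin b) (hn : n + k ≤ T)
    (t : Fin k) : extendWord (overwrite y n v) (n + t) = v t := by
  rw [extendWord_of_lt _ (by omega)]
  simp [overwrite]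

lemma extendWord_overwrite_of_notMem (y : Fin T → Fin b) {n m : ℕ} (v : Fin k → Fin b)
    (hm : m < n ∨ n + k ≤ m) : extendWord (overwrite y n v) m = extendWord y m := by
  unfold extendWord overwrite
  split_ifs with h1 h2
  · simp only at h2
    omega
  · rfl
  · rfl

lemma extendWord_injective : Function.Injective (extendWord : (Fin T → Fin b) → ℕ → Fin b) := by
  intro y y' h
  funext m
  simpa [extendWord_of_lt _ m.2] using congrFun h m

/-- A window of a uniform random word is uniform and independent of the other letters. -/
lemma expect_occInd_mul_of_overwrite (n : ℕ) (hn : n + k ≤ T) (w : Fin k → Fin b)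
    (φ : (Fin T → Fin b) → ℝ)
    (hφ : ∀ y (v : Fin k → Fin b), φ (overwrite y n v) = φ y) :
    𝔼 y, occInd (extendWord y) n w * φ y = ((b : ℝ) ^ k)⁻¹ * 𝔼 y, φ y := by
  have hb : (0 : ℝ) < b := by exact_mod_cast Nat.pos_of_ne_zero (NeZero.ne b)
  have hkey : ∑ p : (Fin T → Fin b) × (Fin k → Fin b), occInd (extendWord p.1) n w * φ p.1 =
      ∑ y, φ y := by
    simp only [occInd, ite_mul, one_mul, zero_mul]
    rw [← Finset.sum_filter]
    refine Finset.sum_nbij' (fun p => overwrite p.1 n p.2)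
      (fun y => (overwrite y n w, fun t => extendWord y (n + t))) ?_ ?_ ?_ ?_ ?_
    · simp
    · intro y _
      simp only [Finset.mem_filter, Finset.mem_univ, true_and, occursAt_succ_iff]
      exact extendWord_overwrite_add y w hn
    · rintro ⟨z, v⟩ hz
      simp only [Finset.mem_filter, Finset.mem_univ, true_and, occursAt_succ_iff] at hz
      refine Prod.ext (extendWord_injective ?_) (funext fun t => extendWord_overwrite_add z v hn t)
      funext m
      by_cases hm : m < n ∨ n + k ≤ m
      · simp only [extendWord_overwrite_of_notMem _ _ hm]
      · obtain ⟨t, rfl⟩ : ∃ t : Fin k, m = n + t := ⟨⟨m - n, by omega⟩, by simp; omega⟩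
        simp only [extendWord_overwrite_add _ _ hn, hz t]
    · intro y _
      refine extendWord_injective (funext fun m => ?_)
      by_cases hm : m < n ∨ n + k ≤ m
      · simp only [extendWord_overwrite_of_notMem _ _ hm]
      · obtain ⟨t, rfl⟩ : ∃ t : Fin k, m = n + t := ⟨⟨m - n, by omega⟩, by simp; omega⟩
        simp only [extendWord_overwrite_add _ _ hn]
    · intro p _
      exact (hφ p.1 p.2).symm
  rw [Fintype.sum_prod_type] at hkey
  simp only [Finset.sum_const, Finset.card_univ, Fintype.card_fun, Fintype.card_fin,
    nsmul_eq_mul, ← Finset.mul_sum] at hkey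
  rw [Fintype.expect_eq_sum_div_card, Fintype.expect_eq_sum_div_card, ← hkey]
  push_cast
  field_simp

/-- For a uniform random pair `(y, w)`, occurrences of `w` at two distinct positions of `y` are
(pairwise) independent, even when they overlap. -/
lemma expect_occInd_mul_occInd_le {l n : ℕ} (hln : l < n) (hn : n + k ≤ T) :
    𝔼 p : (Fin T → Fin b) × (Fin k → Fin b),
      occInd (extendWord p.1) n p.2 * occInd (extendWord p.1) l p.2 ≤ (((b : ℝ) ^ k)⁻¹) ^ 2 := by
  have hb : (0 : ℝ) < b := by exact_mod_cast Nat.pos_of_ne_zero (NeZero.ne b)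
  set E : Finset ((Fin T → Fin b) × (Fin k → Fin b)) := Finset.univ.filter fun p =>
    OccursAt (extendWord p.1) (n + 1) p.2 ∧ OccursAt (extendWord p.1) (l + 1) p.2 with hE
  have hcard : E.card * b ^ k ≤ b ^ T := by
    have hmaps : (E ×ˢ (Finset.univ : Finset (Fin k → Fin b))).card ≤
        (Finset.univ : Finset (Fin T → Fin b)).card := by
      refine Finset.card_le_card_of_injOn (fun p => overwrite p.1.1 n p.2) (by simp) ?_
      rintro ⟨⟨y, w⟩, v⟩ hp ⟨⟨y', w'⟩, v'⟩ hp' heq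
      simp only [hE, Finset.coe_product, Set.mem_prod, Finset.mem_coe, Finset.mem_filter,
        Finset.mem_univ, true_and, and_true, occursAt_succ_iff] at hp hp' heq
      have hlet : ∀ m, extendWord y m = extendWord y' m := by
        intro m
        induction m using Nat.strong_induction_on with
        | _ m ih =>
          by_cases hm : m < n ∨ n + k ≤ m
          · rw [← extendWord_overwrite_of_notMem y v hm, heq,
              extendWord_overwrite_of_notMem y' v' hm]
          · obtain ⟨t, rfl⟩ : ∃ t : Fin k, m = n + t := ⟨⟨m - n, by omega⟩, by simp; omega⟩
            rw [hp.1 t, ← hp.2 t, hp'.1 t, ← hp'.2 t]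
            exact ih _ (by omega)
      have hv : v = v' := funext fun t => by
        rw [← extendWord_overwrite_add y v hn t, heq, extendWord_overwrite_add y' v' hn t]
      have hw : w = w' := funext fun t => by rw [← hp.1 t, hlet, hp'.1 t]
      rw [hv, hw, extendWord_injective (funext hlet)]
    simpa using hmaps
  have hsum : ∑ p : (Fin T → Fin b) × (Fin k → Fin b),
      occInd (extendWord p.1) n p.2 * occInd (extendWord p.1) l p.2 = E.card := by
    rw [hE, Finset.card_filter]
    push_cast
    refine Finset.sum_congr rfl fun p _ => ?_
    unfold occInd
    split_ifs <;> simp_all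
  have hcard' : (E.card : ℝ) * (b : ℝ) ^ k ≤ (b : ℝ) ^ T := by exact_mod_cast hcard
  rw [Fintype.expect_eq_sum_div_card, hsum]
  simp only [Fintype.card_prod, Fintype.card_fun, Fintype.card_fin]
  push_cast
  rw [div_le_iff₀ (by positivity)]
  field_simp
  exact hcard'

end

section

variable {b k T : ℕ} [NeZero b]

/-- For a function `φ` of `y` and `w` that ignores a window of `y`, the occurrence of `w` at that
window is independent of `φ`. -/
lemma expect_occInd_mul (n : ℕ) (hn : n + k ≤ T) (φ : (Fin T → Fin b) → (Fin k → Fin b) → ℝ)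
    (hφ : ∀ y w (v : Fin k → Fin b), φ (overwrite y n v) w = φ y w) :
    𝔼 p : (Fin T → Fin b) × (Fin k → Fin b), occInd (extendWord p.1) n p.2 * φ p.1 p.2 =
      ((b : ℝ) ^ k)⁻¹ * 𝔼 p : (Fin T → Fin b) × (Fin k → Fin b), φ p.1 p.2 := by
  have hswap : ∀ ψ : (Fin T → Fin b) → (Fin k → Fin b) → ℝ,
      𝔼 p : (Fin T → Fin b) × (Fin k → Fin b), ψ p.1 p.2 = 𝔼 w, 𝔼 y, ψ y w := fun ψ => by
    rw [Finset.expect_comm, ← Finset.expect_product', Finset.univ_product_univ]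
  rw [hswap φ, hswap fun y w => occInd (extendWord y) n w * φ y w, Finset.mul_expect]
  exact Finset.expect_congr rfl fun w _ =>
    expect_occInd_mul_of_overwrite n hn w _ fun y v => hφ y w v

lemma expect_occInd (n : ℕ) (hn : n + k ≤ T) :
    𝔼 p : (Fin T → Fin b) × (Fin k → Fin b), occInd (extendWord p.1) n p.2 =
      ((b : ℝ) ^ k)⁻¹ := by
  simpa using expect_occInd_mul (b := b) n hn (fun _ _ => 1) fun _ _ _ => rfl

/-- An occurrence of `w` at a given position is almost independent of the number of occurrences
at earlier positions. -/
lemma abs_expect_occInd_mul_occCount_sub_le (n : ℕ) (hn : n + k ≤ T) (h : ℕ → ℝ)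
    (hh : ∀ s, |h s| ≤ 1) :
    |𝔼 p : (Fin T → Fin b) × (Fin k → Fin b),
        occInd (extendWord p.1) n p.2 * h (occCount (extendWord p.1) p.2 n) -
      ((b : ℝ) ^ k)⁻¹ * 𝔼 p : (Fin T → Fin b) × (Fin k → Fin b),
        h (occCount (extendWord p.1) p.2 n)| ≤ 4 * k * (((b : ℝ) ^ k)⁻¹) ^ 2 := by
  set q : ℝ := ((b : ℝ) ^ k)⁻¹ with hq
  have hq0 : 0 ≤ q := by positivity
  obtain ⟨m, hm⟩ : ∃ m, m = n + 1 - k := ⟨_, rfl⟩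
  rcases Nat.eq_zero_or_pos k with hk0 | hk
  · have h1 := expect_occInd_mul (b := b) n hn (fun y w => h (occCount (extendWord y) w n))
      fun y w v => by
        have : overwrite y n v = y := by
          funext t
          exact dif_neg (by omega)
        rw [this]
    rw [h1, ← hq, sub_self, abs_zero]
    positivity
  have hmn : m ≤ n := by omega
  have hindep := expect_occInd_mul (b := b) n hn (fun y w => h (occCount (extendWord y) w m))
    fun y w v => by
      congr 1
      refine occCount_congr w fun j hj => occursAt_congr w fun l _ hl => ?_
      exact extendWord_overwrite_of_notMem _ _ (Or.inl (by omega))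
  rw [← hq] at hindep
  have hcard : ((Finset.Ico m n).card : ℝ) ≤ k := by
    rw [Nat.card_Ico]
    exact_mod_cast (by omega : n - m ≤ k)
  have hnear : |𝔼 p : (Fin T → Fin b) × (Fin k → Fin b),
        occInd (extendWord p.1) n p.2 * h (occCount (extendWord p.1) p.2 n) -
      𝔼 p : (Fin T → Fin b) × (Fin k → Fin b),
        occInd (extendWord p.1) n p.2 * h (occCount (extendWord p.1) p.2 m)| ≤
      2 * (k * q ^ 2) := by
    rw [← Finset.expect_sub_distrib]
    calc _ ≤ 𝔼 p : (Fin T → Fin b) × (Fin k → Fin b), 2 * ∑ l ∈ Finset.Ico m n,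
            occInd (extendWord p.1) n p.2 * occInd (extendWord p.1) l p.2 := by
          refine (Finset.abs_expect_le _ _).trans (Finset.expect_le_expect fun p _ => ?_)
          rw [← mul_sub, abs_mul, abs_of_nonneg (occInd_nonneg _ _ _), ← Finset.mul_sum,
            mul_left_comm]
          exact mul_le_mul_of_nonneg_left (abs_apply_occCount_sub_le hh _ _ hmn)
            (occInd_nonneg _ _ _)
      _ = 2 * ∑ l ∈ Finset.Ico m n, 𝔼 p : (Fin T → Fin b) × (Fin k → Fin b),
            occInd (extendWord p.1) n p.2 * occInd (extendWord p.1) l p.2 := by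
          rw [← Finset.mul_expect, Finset.expect_sum_comm]
      _ ≤ 2 * ∑ l ∈ Finset.Ico m n, q ^ 2 := by
          gcongr with l hl
          exact expect_occInd_mul_occInd_le (Finset.mem_Ico.mp hl).2 hn
      _ ≤ _ := by
          rw [Finset.sum_const, nsmul_eq_mul]
          gcongr
  have hfar : |𝔼 p : (Fin T → Fin b) × (Fin k → Fin b), h (occCount (extendWord p.1) p.2 m) -
      𝔼 p : (Fin T → Fin b) × (Fin k → Fin b), h (occCount (extendWord p.1) p.2 n)| ≤
      2 * (k * q) := by
    rw [abs_sub_comm, ← Finset.expect_sub_distrib]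
    calc _ ≤ 𝔼 p : (Fin T → Fin b) × (Fin k → Fin b), 2 * ∑ l ∈ Finset.Ico m n,
            occInd (extendWord p.1) l p.2 :=
          (Finset.abs_expect_le _ _).trans
            (Finset.expect_le_expect fun p _ => abs_apply_occCount_sub_le hh _ _ hmn)
      _ = 2 * ∑ l ∈ Finset.Ico m n, 𝔼 p : (Fin T → Fin b) × (Fin k → Fin b),
            occInd (extendWord p.1) l p.2 := by
          rw [← Finset.mul_expect, Finset.expect_sum_comm]
      _ = 2 * ∑ l ∈ Finset.Ico m n, q := by
          congr 1
          refine Finset.sum_congr rfl fun l hl => expect_occInd l ?_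
          have := (Finset.mem_Ico.mp hl).2
          omega
      _ ≤ _ := by
          rw [Finset.sum_const, nsmul_eq_mul]
          gcongr
  rw [hindep] at hnear
  have hfar' := mul_le_mul_of_nonneg_left hfar hq0
  rw [← abs_of_nonneg hq0, ← abs_mul, abs_of_nonneg hq0, mul_sub] at hfar'
  have := abs_add_le _ _ |>.trans (add_le_add hnear hfar')
  rw [sub_add_sub_cancel] at this
  linarith

/-- Poisson approximation for the number of occurrences of a random word in a random word. -/
lemma abs_expect_occCount_eq_sub_poissonWeight_le (n : ℕ) (hn : n + k ≤ T + 1) (i : ℕ) :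
    |𝔼 p : (Fin T → Fin b) × (Fin k → Fin b),
        (if occCount (extendWord p.1) p.2 n = i then (1 : ℝ) else 0) -
      poissonWeight (n * ((b : ℝ) ^ k)⁻¹) i| ≤ n * ((4 * k + 2) * (((b : ℝ) ^ k)⁻¹) ^ 2) := by
  set q : ℝ := ((b : ℝ) ^ k)⁻¹ with hq
  have hb : (1 : ℝ) ≤ b := by exact_mod_cast Nat.pos_of_ne_zero (NeZero.ne b)
  have hq0 : 0 ≤ q := by positivity
  have hq1 : q ≤ 1 := inv_le_one_of_one_le₀ (one_le_pow₀ hb)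
  induction n generalizing i with
  | zero =>
    simp [occCount, poissonWeight_zero, eq_comm]
  | succ n ih =>
    set a : ℕ → ℝ := fun i => 𝔼 p : (Fin T → Fin b) × (Fin k → Fin b),
        (if occCount (extendWord p.1) p.2 n = i then (1 : ℝ) else 0) with ha
    replace ih : ∀ i, |a i - poissonWeight (n * q) i| ≤ n * ((4 * k + 2) * q ^ 2) :=
      fun i => ih (by omega) i
    have hprec : |precWeight a i - precWeight (poissonWeight (n * q)) i| ≤
        n * ((4 * k + 2) * q ^ 2) := by
      cases i with
      | zero =>
        simp only [precWeight, sub_self, abs_zero]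
        positivity
      | succ i => exact ih i
    set h : ℕ → ℝ := fun s => (if s + 1 = i then 1 else 0) - (if s = i then 1 else 0) with hh
    have hstep := abs_expect_occInd_mul_occCount_sub_le (b := b) (T := T) (k := k) n (by omega) h
      fun s => by simp only [hh]; split_ifs <;> norm_num
    have hmean : 𝔼 p : (Fin T → Fin b) × (Fin k → Fin b),
        h (occCount (extendWord p.1) p.2 n) = precWeight a i - a i := by
      simp only [hh, Finset.expect_sub_distrib]
      congr 1
      cases i with
      | zero => simp [precWeight]
      | succ i => simp [precWeight, ha]
    have hsucc : 𝔼 p : (Fin T → Fin b) × (Fin k → Fin b),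
        (if occCount (extendWord p.1) p.2 (n + 1) = i then (1 : ℝ) else 0) =
        a i + 𝔼 p : (Fin T → Fin b) × (Fin k → Fin b),
          occInd (extendWord p.1) n p.2 * h (occCount (extendWord p.1) p.2 n) := by
      rw [ha, ← Finset.expect_add_distrib]
      exact Finset.expect_congr rfl fun p _ =>
        apply_occCount_succ (fun s => if s = i then (1 : ℝ) else 0) _ _ _
    have hpois := abs_poissonWeight_add_sub_le (t := n * q) (by positivity) hq0 i
    rw [hmean, ← hq] at hstep
    rw [hsucc]
    have hcast : ((n + 1 : ℕ) : ℝ) * q = n * q + q := by push_cast; ring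
    rw [hcast]
    push_cast
    have h1 := mul_le_mul_of_nonneg_left (ih i) (sub_nonneg.mpr hq1)
    have h2 := mul_le_mul_of_nonneg_left hprec hq0
    rw [← abs_of_nonneg (sub_nonneg.mpr hq1), ← abs_mul,
      abs_of_nonneg (sub_nonneg.mpr hq1)] at h1
    rw [← abs_of_nonneg hq0, ← abs_mul, abs_of_nonneg hq0] at h2
    rw [abs_le] at *
    constructor <;> nlinarith [h1.1, h1.2, h2.1, h2.2, hstep.1, hstep.2, hpois.1, hpois.2]

end

/-- The proportion of words of length `k` occurring exactly `i` times in `x` among the first `n`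
positions. -/
noncomputable def occFreq {b : ℕ} (k : ℕ) (x : ℕ → Fin b) (n i : ℕ) : ℝ :=
  ((Finset.univ.filter fun w : Fin k → Fin b => occCount x w n = i).card : ℝ) / (b : ℝ) ^ k

section

variable {b k : ℕ}

lemma occFreq_eq_expect (x : ℕ → Fin b) (n i : ℕ) :
    occFreq k x n i = 𝔼 w : Fin k → Fin b, if occCount x w n = i then (1 : ℝ) else 0 := by
  rw [occFreq, Fintype.expect_eq_sum_div_card, Finset.card_filter]
  simp

lemma occFreq_congr {x x' : ℕ → Fin b} {n : ℕ} (i : ℕ) (h : ∀ m < n + k, x m = x' m) :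
    occFreq k x n i = occFreq k x' n i := by
  unfold occFreq
  congr 4
  funext w
  rw [occCount_congr w fun j hj => occursAt_congr w fun m _ hm => h m (by omega)]

lemma Mx_Ioc_eq_occCount (hb : 0 < b) {lam : ℝ} (hlam : 0 ≤ lam) (x : ℕ → Fin b)
    (w : Fin k → Fin b) :
    Mx b k (Set.Ioc 0 lam) x w = occCount x w ⌊lam * (b : ℝ) ^ k⌋₊ := by
  have hbk : (0 : ℝ) < (b : ℝ) ^ k := by positivity
  rw [Mx, occCount, ← Finset.card_map (addRightEmbedding 1), ← Set.ncard_coe_finset]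
  congr 1
  ext j
  simp only [Set.mem_ofPred_eq, Set.mem_Ioc, Finset.coe_map, Finset.coe_filter,
    Finset.mem_range, Set.mem_image, addRightEmbedding_apply]
  constructor
  · rintro ⟨hj, ⟨-, hle⟩, hocc⟩
    have hj' : j - 1 + 1 = j := by omega
    refine ⟨j - 1, ⟨?_, by rwa [hj']⟩, hj'⟩
    have : j ≤ ⌊lam * (b : ℝ) ^ k⌋₊ := Nat.le_floor ((div_le_iff₀ hbk).mp hle)
    omega
  · rintro ⟨l, ⟨hl, hocc⟩, rfl⟩
    refine ⟨by omega, ⟨by positivity, ?_⟩, hocc⟩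
    rw [div_le_iff₀ hbk]
    exact (Nat.le_floor_iff (by positivity)).mp hl

lemma toReal_muK_Mx_eq (hb : 0 < b) {lam : ℝ} (hlam : 0 ≤ lam) (x : ℕ → Fin b) (i : ℕ) :
    ((muK b k) {w : Fin k → Fin b | Mx b k (Set.Ioc 0 lam) x w = i}).toReal =
      occFreq k x ⌊lam * (b : ℝ) ^ k⌋₊ i := by
  have hset : {w : Fin k → Fin b | Mx b k (Set.Ioc 0 lam) x w = i} =
      ((Finset.univ.filter fun w : Fin k → Fin b =>
        occCount x w ⌊lam * (b : ℝ) ^ k⌋₊ = i : Finset _) : Set (Fin k → Fin b)) := by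
    ext w
    simp [Mx_Ioc_eq_occCount hb hlam]
  rw [hset, muK, Measure.smul_apply, Measure.count_apply_finset, occFreq]
  simp [div_eq_inv_mul]

/-- Changing `k` consecutive letters of `x` affects the counts of at most `4 * k` words. -/
lemma occFreq_le_add (x x' : ℕ → Fin b) (n i s : ℕ)
    (h : ∀ m, m < s ∨ s + k ≤ m → x m = x' m) :
    occFreq k x n i ≤ occFreq k x' n i + 4 * k / (b : ℝ) ^ k := by
  classical
  set J : Finset ℕ := Finset.Ico (s + 1 - k) (s + k) with hJ
  set window : (ℕ → Fin b) → ℕ → (Fin k → Fin b) := fun x j t => x (j + t) with hwindow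
  have hsub : (Finset.univ.filter fun w : Fin k → Fin b => occCount x w n = i) ⊆
      (Finset.univ.filter fun w : Fin k → Fin b => occCount x' w n = i) ∪
        (J.image (window x) ∪ J.image (window x')) := by
    intro w hw
    by_cases hmem : w ∈ J.image (window x) ∪ J.image (window x')
    · exact Finset.mem_union_right _ hmem
    · refine Finset.mem_union_left _ ?_
      simp only [Finset.mem_filter, Finset.mem_univ, true_and] at hw ⊢
      rw [← hw]
      refine occCount_congr w fun j _ => ?_
      by_cases hj : j ∈ J
      · have h1 : ¬ OccursAt x (j + 1) w := fun hocc => hmem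
          (Finset.mem_union_left _ (Finset.mem_image.mpr ⟨j, hj, funext hocc⟩))
        have h2 : ¬ OccursAt x' (j + 1) w := fun hocc => hmem
          (Finset.mem_union_right _ (Finset.mem_image.mpr ⟨j, hj, funext hocc⟩))
        exact iff_of_false h2 h1
      · rw [hJ, Finset.mem_Ico] at hj
        exact occursAt_congr w fun m hm1 hm2 => (h m (by omega)).symm
  have hJcard : J.card ≤ 2 * k := by
    rw [hJ, Nat.card_Ico]
    omega
  have hcard : (Finset.univ.filter fun w : Fin k → Fin b => occCount x w n = i).card ≤
      (Finset.univ.filter fun w : Fin k → Fin b => occCount x' w n = i).card + 4 * k := by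
    refine (Finset.card_le_card hsub).trans ((Finset.card_union_le _ _).trans ?_)
    have h1 := Finset.card_union_le (J.image (window x)) (J.image (window x'))
    have h2 := Finset.card_image_le (s := J) (f := window x)
    have h3 := Finset.card_image_le (s := J) (f := window x')
    omega
  rw [occFreq, occFreq, ← add_div]
  gcongr
  exact_mod_cast hcard

/-- At most `n` words occur at all among the first `n` positions. -/
lemma card_filter_occCount_ne_zero_le (x : ℕ → Fin b) (n : ℕ) :
    (Finset.univ.filter fun w : Fin k → Fin b => occCount x w n ≠ 0).card ≤ n := by
  classical
  have hsub : (Finset.univ.filter fun w : Fin k → Fin b => occCount x w n ≠ 0) ⊆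
      (Finset.range n).image fun j t => x (j + t) := by
    intro w hw
    simp only [Finset.mem_filter, Finset.mem_univ, true_and, occCount, ne_eq,
      Finset.card_eq_zero, ← Finset.nonempty_iff_ne_empty] at hw
    obtain ⟨j, hj⟩ := hw
    exact Finset.mem_image.mpr ⟨j, (Finset.mem_filter.mp hj).1,
      funext (Finset.mem_filter.mp hj).2⟩
  simpa using (Finset.card_le_card hsub).trans Finset.card_image_le

/-- For small `lam` the occurrence frequencies are trivially close to the Poisson weights. -/
lemma abs_occFreq_sub_poissonWeight_le (hb : 0 < b) {lam : ℝ} (hlam : 0 ≤ lam) (hlam1 : lam ≤ 1)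
    (x : ℕ → Fin b) (i : ℕ) :
    |occFreq k x ⌊lam * (b : ℝ) ^ k⌋₊ i - poissonWeight lam i| ≤ lam := by
  have hbk : (0 : ℝ) < (b : ℝ) ^ k := by positivity
  set n := ⌊lam * (b : ℝ) ^ k⌋₊ with hn
  have hnle : (n : ℝ) ≤ lam * (b : ℝ) ^ k := Nat.floor_le (by positivity)
  have hne := card_filter_occCount_ne_zero_le (k := k) x n
  have hne' : ((Finset.univ.filter fun w : Fin k → Fin b => occCount x w n ≠ 0).card : ℝ) ≤
      lam * (b : ℝ) ^ k := le_trans (by exact_mod_cast hne) hnle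
  rcases Nat.eq_zero_or_pos i with rfl | hi
  · have htot := Finset.card_filter_add_card_filter_not (s := Finset.univ)
      (fun w : Fin k → Fin b => occCount x w n = 0)
    have htot' : ((Finset.univ.filter fun w : Fin k → Fin b => occCount x w n = 0).card : ℝ) +
        (Finset.univ.filter fun w : Fin k → Fin b => occCount x w n ≠ 0).card =
          (b : ℝ) ^ k := by
      rw [Finset.card_univ, Fintype.card_fun, Fintype.card_fin, Fintype.card_fin] at htot
      exact_mod_cast htot
    have h1 : 1 - lam ≤ occFreq k x n 0 := by
      rw [occFreq, le_div_iff₀ hbk]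
      linarith
    have h2 : occFreq k x n 0 ≤ 1 := by
      rw [occFreq, div_le_one hbk]
      linarith [Nat.cast_nonneg (α := ℝ)
        (Finset.univ.filter fun w : Fin k → Fin b => occCount x w n ≠ 0).card]
    have h3 : 1 - lam ≤ poissonWeight lam 0 := by
      have := Real.add_one_le_exp (-lam)
      simp only [poissonWeight, pow_zero, mul_one, Nat.factorial_zero, Nat.cast_one, div_one]
      linarith
    have h4 := poissonWeight_le_one hlam 0
    rw [abs_le]
    constructor <;> linarith
  · have h1 : 0 ≤ occFreq k x n i := by unfold occFreq; positivity
    have h2 : occFreq k x n i ≤ lam := by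
      rw [occFreq, div_le_iff₀ hbk]
      refine le_trans ?_ hne'
      refine Nat.cast_le.mpr (Finset.card_le_card fun w hw => ?_)
      simp only [Finset.mem_filter, Finset.mem_univ, true_and] at hw ⊢
      omega
    have h3 := poissonWeight_nonneg hlam i
    have h4 : poissonWeight lam i ≤ lam := by
      have e1 : Real.exp (-lam) ≤ 1 := Real.exp_le_one_iff.mpr (by linarith)
      have e2 : lam ^ i ≤ lam := by
        simpa using pow_le_pow_of_le_one hlam hlam1 hi
      have e3 : (1 : ℝ) ≤ (i.factorial : ℝ) := by exact_mod_cast i.factorial_pos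
      unfold poissonWeight
      refine (div_le_self (by positivity) e3).trans ?_
      calc Real.exp (-lam) * lam ^ i ≤ 1 * lam := by gcongr
        _ = lam := one_mul _
    rw [abs_le]
    constructor <;> linarith

/-- Concatenation of `B` blocks of length `k`. -/
def concatBlocks (B : ℕ) : (Fin B → Fin k → Fin b) ≃ (Fin (B * k) → Fin b) :=
  (Equiv.curry (Fin B) (Fin k) (Fin b)).symm.trans
    (Equiv.arrowCongr finProdFinEquiv (Equiv.refl _))

lemma concatBlocks_apply {B : ℕ} (y : Fin B → Fin k → Fin b) (t : Fin (B * k)) :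
    concatBlocks B y t = y t.divNat t.modNat := rfl

/-- Concentration of the occurrence frequencies around their mean. -/
lemma card_filter_abs_occFreq_sub_gt_le [NeZero b] (hk : 0 < k) {B : ℕ} (hB : 0 < B) (n i : ℕ)
    {t : ℝ} (ht : 0 < t) :
    ((Finset.univ.filter fun y : Fin (B * k) → Fin b =>
        t < |occFreq k (extendWord y) n i -
          𝔼 y' : Fin (B * k) → Fin b, occFreq k (extendWord y') n i|).card : ℝ) ≤
      (b : ℝ) ^ (B * k) * (2 * Real.exp (-2 * t ^ 2 / (B * (4 * k / (b : ℝ) ^ k) ^ 2))) := by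
  have hb : (0 : ℝ) < b := by exact_mod_cast Nat.pos_of_ne_zero (NeZero.ne b)
  have hk' : (0 : ℝ) < k := by exact_mod_cast hk
  have hdiff : ∀ (m : Fin B) (y y' : Fin B → Fin k → Fin b), (∀ l, l ≠ m → y l = y' l) →
      occFreq k (extendWord (concatBlocks B y)) n i ≤
        occFreq k (extendWord (concatBlocks B y')) n i + 4 * k / (b : ℝ) ^ k := by
    intro m y y' h
    refine occFreq_le_add _ _ n i (m * k) fun l hl => ?_
    unfold extendWord
    split_ifs with hlt
    · rw [concatBlocks_apply, concatBlocks_apply, h _ fun hm => ?_]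
      have hdiv : l / k = m := congrArg Fin.val hm
      have h1 := Nat.div_mul_le_self l k
      have h2 := Nat.lt_div_mul_add (a := l) hk
      rw [hdiv] at h1 h2
      omega
    · rfl
  have key := card_filter_abs_sub_expect_gt_le B hB
    (fun y : Fin B → Fin k → Fin b => occFreq k (extendWord (concatBlocks B y)) n i)
    (4 * k / (b : ℝ) ^ k) t (by positivity) ht fun m y y' h => by
      rw [abs_le]
      constructor <;> linarith [hdiff m y y' h, hdiff m y' y fun l hl => (h l hl).symm]
  have hmean := Fintype.expect_equiv (concatBlocks (b := b) (k := k) B)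
    (fun y => occFreq k (extendWord (concatBlocks B y)) n i)
    (fun y => occFreq k (extendWord y) n i) fun _ => rfl
  rw [hmean] at key
  have hcard : (Fintype.card (Fin B → Fin k → Fin b) : ℝ) = (b : ℝ) ^ (B * k) := by
    simp [mul_comm B k, pow_mul]
  rw [hcard] at key
  refine le_trans (le_of_eq ?_) key
  congr 1
  refine (Finset.card_equiv (concatBlocks B) fun y => ?_).symm
  simp

/-- The product measure of an event determined by the first `T` letters. -/
lemma IsUnifProductMeasure.measure_le {ν : Measure (ℕ → Fin b)} (hν : IsUnifProductMeasure b ν)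
    (T : ℕ) (P : (Fin T → Fin b) → Prop) [DecidablePred P] :
    ν {x | P fun t => x t} ≤ ((Finset.univ.filter P).card : ENNReal) * ((b : ENNReal)⁻¹) ^ T := by
  have hsub : {x : ℕ → Fin b | P fun t : Fin T => x t} ⊆
      ⋃ y ∈ Finset.univ.filter P, {x : ℕ → Fin b | ∀ t : Fin T, x (t : ℕ) = y t} := by
    intro x hx
    simp only [Set.mem_iUnion, Finset.mem_filter, Finset.mem_univ, true_and]
    exact ⟨fun t => x t, hx, fun _ => rfl⟩
  refine (measure_mono hsub).trans ((measure_biUnion_finset_le _ _).trans ?_)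
  rw [Finset.sum_congr rfl fun y _ => hν T y, Finset.sum_const, nsmul_eq_mul]

end

lemma mul_pow_four_le_two_pow {k : ℕ} (hk : 24 ≤ k) : 49 * k ^ 4 ≤ 2 ^ k := by
  induction k, hk using Nat.le_induction with
  | base => norm_num
  | succ k hk ih =>
    have : (k + 1) ^ 4 ≤ 2 * k ^ 4 := by
      have h2 : 24 * k ≤ k * k := Nat.mul_le_mul_right k hk
      have h3 : 24 * (k * k) ≤ k * (k * k) := Nat.mul_le_mul_right _ hk
      have h4 : 24 * (k * (k * k)) ≤ k * (k * (k * k)) := Nat.mul_le_mul_right _ hk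
      ring_nf at h2 h3 h4 ⊢
      omega
    rw [pow_succ 2 k]
    omega

/-- The mean occurrence frequency is close to the Poisson weight. -/
lemma abs_expect_occFreq_sub_poissonWeight_le {b k T i : ℕ} [NeZero b] (hb : 2 ≤ b) {lam : ℝ}
    (hlam : 0 ≤ lam) (hk : 24 ≤ k) (hlog : (lam + 1) ^ 2 ≤ 2 ^ k)
    (hT : ⌊lam * (b : ℝ) ^ k⌋₊ + k ≤ T) :
    |𝔼 y : Fin T → Fin b, occFreq k (extendWord y) ⌊lam * (b : ℝ) ^ k⌋₊ i -
      poissonWeight lam i| ≤ 1 / k := by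
  set n := ⌊lam * (b : ℝ) ^ k⌋₊ with hn
  set q : ℝ := ((b : ℝ) ^ k)⁻¹ with hq
  have hb' : (2 : ℝ) ≤ b := by exact_mod_cast hb
  have hk' : (24 : ℝ) ≤ k := by exact_mod_cast hk
  have hbk : (0 : ℝ) < (b : ℝ) ^ k := by positivity
  have hq0 : 0 < q := by positivity
  have hnle : (n : ℝ) * q ≤ lam := by
    have := mul_le_mul_of_nonneg_right (Nat.floor_le (by positivity : 0 ≤ lam * (b : ℝ) ^ k)) hq0.le
    rwa [mul_assoc, mul_inv_cancel₀ hbk.ne', mul_one] at this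
  have hnge : lam ≤ n * q + q := by
    have := mul_le_mul_of_nonneg_right (Nat.lt_floor_add_one (lam * (b : ℝ) ^ k)).le hq0.le
    rwa [mul_assoc, mul_inv_cancel₀ hbk.ne', mul_one, add_mul, one_mul] at this
  have h1 := abs_expect_occCount_eq_sub_poissonWeight_le (b := b) (T := T) (k := k) n
    (by omega) i
  rw [← hq, ← Finset.univ_product_univ, Finset.expect_product] at h1
  simp only [← occFreq_eq_expect] at h1
  have h2 : |poissonWeight (n * q) i - poissonWeight lam i| ≤ q := by
    refine (abs_poissonWeight_sub_le (by positivity) hlam i).trans ?_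
    rw [abs_le]
    constructor <;> linarith
  have h3 : n * ((4 * k + 2) * q ^ 2) ≤ lam * ((4 * k + 2) * q) := by
    have := mul_le_mul_of_nonneg_right hnle (by positivity : 0 ≤ (4 * k + 2) * q)
    linarith
  have h4 : 5 * k * (lam + 1) * q ≤ 1 / k := by
    have hpow : (2 : ℝ) ^ k ≤ (b : ℝ) ^ k := pow_le_pow_left₀ (by norm_num) hb' k
    have hk4 : (49 : ℝ) * (k : ℝ) ^ 4 ≤ 2 ^ k := by exact_mod_cast mul_pow_four_le_two_pow hk
    have hsq : (5 * (k : ℝ) ^ 2 * (lam + 1)) ^ 2 ≤ ((b : ℝ) ^ k) ^ 2 := by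
      calc (5 * (k : ℝ) ^ 2 * (lam + 1)) ^ 2 = (25 * (k : ℝ) ^ 4) * (lam + 1) ^ 2 := by ring
        _ ≤ 2 ^ k * 2 ^ k := by
            refine mul_le_mul ?_ hlog (by positivity) (by positivity)
            linarith [pow_nonneg (by positivity : (0 : ℝ) ≤ k) 4]
        _ ≤ (b : ℝ) ^ k * (b : ℝ) ^ k := by gcongr
        _ = _ := by ring
    have hle := (sq_le_sq₀ (by positivity) (by positivity)).mp hsq
    rw [hq, ← div_eq_mul_inv, div_le_div_iff₀ hbk (by positivity)]
    linarith
  have h5 : lam * ((4 * k + 2) * q) + q ≤ 5 * k * (lam + 1) * q := by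
    have : lam * (4 * k + 2) + 1 ≤ 5 * k * (lam + 1) := by nlinarith
    nlinarith
  have h6 := (abs_sub_le _ _ _).trans (add_le_add h1 h2)
  linarith

/-- The McDiarmid exponent for blocks of length `k` dominates the exponent of the tail bound. -/
lemma blockExponent_le {b k : ℕ} (hb : 2 ≤ b) {lam : ℝ} (hk : 24 ≤ k) (hlam : 2 / (k : ℝ) < lam) :
    -2 * (1 / (k : ℝ)) ^ 2 /
        (((⌊lam * (b : ℝ) ^ k⌋₊ / k + 2 : ℕ) : ℝ) * (4 * k / (b : ℝ) ^ k) ^ 2) ≤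
      -2 * (b : ℝ) ^ k / (lam * (k : ℝ) ^ 4) := by
  have hb' : (2 : ℝ) ≤ b := by exact_mod_cast hb
  have hk' : (24 : ℝ) ≤ k := by exact_mod_cast hk
  have hk0 : (0 : ℝ) < k := by linarith
  have hbk : (0 : ℝ) < (b : ℝ) ^ k := by positivity
  have hlam0 : 0 < lam := lt_trans (by positivity) hlam
  set B : ℕ := ⌊lam * (b : ℝ) ^ k⌋₊ / k + 2 with hB
  have hB0 : (0 : ℝ) < B := by positivity
  have hBle : (B : ℝ) ≤ lam * (b : ℝ) ^ k / 24 + 2 := by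
    rw [hB]
    push_cast
    gcongr
    refine Nat.cast_div_le.trans ?_
    gcongr
    exact Nat.floor_le (by positivity)
  have hlarge : 96 ≤ lam * (b : ℝ) ^ k := by
    have hpow : (2 : ℝ) ^ k ≤ (b : ℝ) ^ k := pow_le_pow_left₀ (by norm_num) hb' k
    have hk4 : (49 : ℝ) * (k : ℝ) ^ 4 ≤ 2 ^ k := by exact_mod_cast mul_pow_four_le_two_pow hk
    have hkk : (k : ℝ) ≤ (k : ℝ) ^ 4 := le_self_pow₀ (by linarith) (by norm_num)
    have h1 : 2 / (k : ℝ) * (49 * k) ≤ lam * (b : ℝ) ^ k :=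
      mul_le_mul hlam.le (by linarith) (by positivity) hlam0.le
    have h2 : 2 / (k : ℝ) * (49 * k) = 98 := by field_simp; norm_num
    linarith
  have hkey : 16 * (B : ℝ) ≤ lam * (b : ℝ) ^ k := by linarith
  have hrew : -2 * (1 / (k : ℝ)) ^ 2 / ((B : ℝ) * (4 * k / (b : ℝ) ^ k) ^ 2) =
      -(2 * ((b : ℝ) ^ k) ^ 2 / (16 * B * (k : ℝ) ^ 4)) := by
    field_simp
    norm_num
  rw [hrew, neg_mul, neg_div, neg_le_neg_iff, div_le_div_iff₀ (by positivity) (by positivity)]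
  have := mul_le_mul_of_nonneg_left hkey (by positivity : 0 ≤ 2 * (b : ℝ) ^ k * (k : ℝ) ^ 4)
  linarith

theorem stmt11 (b : ℕ) (hb : 2 ≤ b) (ν : Measure (ℕ → Fin b))
    (hν : IsUnifProductMeasure b ν) (i : ℕ) (lam : ℝ) (hlam : 0 < lam) (k : ℕ)
    (hk24 : 24 ≤ k) (hklog : 2 * Real.logb 2 (lam + 1) ≤ (k : ℝ)) :
    ν {x : ℕ → Fin b |
        2 / (k : ℝ) <
          |((muK b k) {w : Fin k → Fin b | Mx b k (Set.Ioc 0 lam) x w = i}).toReal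
            - Real.exp (-lam) * lam ^ i / (Nat.factorial i : ℝ)|}
      ≤ ENNReal.ofReal (2 * Real.exp (-2 * (b : ℝ) ^ k / (lam * (k : ℝ) ^ 4))) := by

  have : NeZero b := ⟨by omega⟩
  have hb0 : 0 < b := by omega
  have hk0 : 0 < k := by omega
  have hkR : (0 : ℝ) < k := by exact_mod_cast hk0
  change ν {x : ℕ → Fin b | 2 / (k : ℝ) <
    |((muK b k) {w : Fin k → Fin b | Mx b k (Set.Ioc 0 lam) x w = i}).toReal
      - poissonWeight lam i|} ≤ _
  simp only [toReal_muK_Mx_eq hb0 hlam.le]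
  rcases le_or_gt lam (2 / k) with hsmall | hlarge
  · have hlam1 : lam ≤ 1 := by
      refine hsmall.trans ((div_le_one hkR).mpr ?_)
      exact_mod_cast (by omega : 2 ≤ k)
    have hempty : {x : ℕ → Fin b | 2 / (k : ℝ) <
        |occFreq k x ⌊lam * (b : ℝ) ^ k⌋₊ i - poissonWeight lam i|} = ∅ := by
      refine Set.eq_empty_of_forall_notMem fun x hx => not_le.mpr (Set.mem_ofPred_eq ▸ hx) ?_
      exact (abs_occFreq_sub_poissonWeight_le hb0 hlam.le hlam1 x i).trans hsmall
    rw [hempty, measure_empty]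
    exact zero_le
  have hlog : (lam + 1) ^ 2 ≤ 2 ^ k := by
    have h1 : Real.logb 2 ((lam + 1) ^ 2) ≤ k := by
      rw [Real.logb_pow]
      exact_mod_cast hklog
    rw [Real.logb_le_iff_le_rpow (by norm_num) (by positivity), Real.rpow_natCast] at h1
    exact h1
  set n := ⌊lam * (b : ℝ) ^ k⌋₊ with hn
  obtain ⟨B, hB⟩ : ∃ B, B = n / k + 2 := ⟨_, rfl⟩
  have hT : n + k ≤ B * k := by
    have := Nat.lt_div_mul_add (a := n) hk0
    rw [hB, add_mul]
    omega
  have hbias := abs_expect_occFreq_sub_poissonWeight_le (i := i) hb hlam.le hk24 hlog hT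
  rw [← hn] at hbias
  have hconc := card_filter_abs_occFreq_sub_gt_le (b := b) hk0 (hB ▸ Nat.succ_pos _ : 0 < B) n i
    (by positivity : 0 < 1 / (k : ℝ))
  set P : (Fin (B * k) → Fin b) → Prop := fun y => 1 / (k : ℝ) <
    |occFreq k (extendWord y) n i -
      𝔼 y' : Fin (B * k) → Fin b, occFreq k (extendWord y') n i| with hP
  have hsub : {x : ℕ → Fin b | 2 / (k : ℝ) < |occFreq k x n i - poissonWeight lam i|} ⊆
      {x | P fun t => x t} := by
    intro x hx
    simp only [Set.mem_ofPred_eq, hP] at hx ⊢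
    rw [occFreq_congr i fun m hm =>
      (extendWord_of_lt (fun t : Fin (B * k) => x t) (hm.trans_le hT)).symm] at hx
    have h1 := abs_sub_le (occFreq k (extendWord fun t : Fin (B * k) => x t) n i)
      (𝔼 y' : Fin (B * k) → Fin b, occFreq k (extendWord y') n i) (poissonWeight lam i)
    have h2 : 2 / (k : ℝ) = 1 / k + 1 / k := by ring
    linarith
  refine (measure_mono hsub).trans ((hν.measure_le (B * k) P).trans ?_)
  have hexp := blockExponent_le hb hk24 hlarge
  rw [← hn, ← hB] at hexp
  have hbT : (0 : ℝ) < (b : ℝ) ^ (B * k) := by positivity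
  have hfinal : ((Finset.univ.filter P).card : ℝ) * ((b : ℝ)⁻¹) ^ (B * k) ≤
      2 * Real.exp (-2 * (b : ℝ) ^ k / (lam * (k : ℝ) ^ 4)) := by
    rw [inv_pow, ← div_eq_mul_inv, div_le_iff₀' hbT]
    refine hconc.trans ?_
    gcongr
  refine le_trans (le_of_eq ?_) (ENNReal.ofReal_le_ofReal hfinal)
  rw [ENNReal.ofReal_mul (by positivity), ENNReal.ofReal_pow (by positivity),
    ENNReal.ofReal_inv_of_pos (by positivity), ENNReal.ofReal_natCast, ENNReal.ofReal_natCast]
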